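/- Tweedie's formula: Let Y₀ be an ℝ^D-valued random vector with E‖Y₀‖ < ∞, Z ∼ N(0, I_D) independent of Y₀, and Y_t = α Y₀ + σ Z with α > 0, σ > 0. Let p_t denote the (smooth, positive) density of Y_t. Then E[Y₀ | Y_t = y] = (y + σ² ∇ log p_t(y))/α for almost every y. -/

import Mathlib

open MeasureTheory ProbabilityTheory Real

/-- Isotropic Gaussian density on `ℝ^D` with variance `σ²·I_D`. -/
noncomputable def gaussDens (D : ℕ) (σ : ℝ) (z : EuclideanSpace ℝ (Fin D)) : ℝ :=
  (2 * π * σ ^ 2) ^ (-(D : ℝ) / 2) * Real.exp (-‖z‖ ^ 2 / (2 * σ ^ 2))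

/-- The standard Gaussian `N(0, I_D)` on `ℝ^D`. -/
noncomputable def stdGaussian (D : ℕ) : Measure (EuclideanSpace ℝ (Fin D)) :=
  (Measure.pi fun _ : Fin D => gaussianReal 0 1).map
    (EuclideanSpace.equiv (Fin D) ℝ).symm

open scoped NNReal ENNReal

lemma pi_gaussianReal_eq_withDensity {ι : Type*} [Fintype ι] (m : ι → ℝ) {v : ℝ≥0}
    (hv : v ≠ 0) :
    Measure.pi (fun i => gaussianReal (m i) v) =
      (volume : Measure (ι → ℝ)).withDensity
        (fun x => ENNReal.ofReal (∏ i, gaussianPDFReal (m i) v (x i))) := by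
  refine Measure.pi_eq fun s hs => ?_
  rw [withDensity_apply _ (MeasurableSet.univ_pi hs), volume_pi, Measure.restrict_pi_pi,
    ← ofReal_integral_eq_lintegral_ofReal, integral_fintype_prod_eq_prod,
    ENNReal.ofReal_prod_of_nonneg]
  · refine Finset.prod_congr rfl fun i _ => ?_
    rw [gaussianReal_apply_eq_integral _ hv]
  · exact fun i _ => integral_nonneg fun x => gaussianPDFReal_nonneg _ _ _
  · exact Integrable.fintype_prod_dep fun i => (integrable_gaussianPDFReal _ _).restrict
  · exact ae_of_all _ fun x => Finset.prod_nonneg fun i _ => gaussianPDFReal_nonneg _ _ _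

lemma prod_gaussianPDFReal_eq_gaussDens {D : ℕ} {σ : ℝ} (hσ : 0 < σ)
    (a y : EuclideanSpace ℝ (Fin D)) :
    ∏ i, gaussianPDFReal (a i) (.mk (σ ^ 2) (sq_nonneg σ)) (y i) = gaussDens D σ (y - a) := by
  have hpos : 0 < 2 * π * σ ^ 2 := by positivity
  simp only [gaussianPDFReal, gaussDens, Finset.prod_mul_distrib, ← Real.exp_sum,
    EuclideanSpace.norm_sq_eq, NNReal.coe_mk, PiLp.sub_apply, Real.norm_eq_abs, sq_abs,
    Finset.prod_const, Finset.card_univ, Fintype.card_fin, ← Finset.sum_div,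
    Finset.sum_neg_distrib]
  congr 1
  rw [Real.sqrt_eq_rpow, ← Real.rpow_neg hpos.le, ← Real.rpow_natCast, ← Real.rpow_mul hpos.le]
  congr 1
  ring

lemma map_affine_stdGaussian {D : ℕ} {σ : ℝ} (hσ : 0 < σ) (a : EuclideanSpace ℝ (Fin D)) :
    (_root_.stdGaussian D).map (fun z => a + σ • z) =
      volume.withDensity (fun y => ENNReal.ofReal (gaussDens D σ (y - a))) := by
  have hcoord (i : Fin D) : (gaussianReal 0 1).map (fun t : ℝ => a i + σ * t) =
      gaussianReal (a i) (.mk (σ ^ 2) (sq_nonneg σ)) := by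
    have : (fun t : ℝ => a i + σ * t) = (a i + ·) ∘ (σ * ·) := rfl
    rw [this, ← Measure.map_map (by fun_prop) (by fun_prop), gaussianReal_map_const_mul,
      gaussianReal_map_const_add]
    simp
  have hv : (.mk (σ ^ 2) (sq_nonneg σ) : ℝ≥0) ≠ 0 := by
    rw [ne_eq, ← NNReal.coe_eq_zero]
    exact (pow_pos hσ 2).ne'
  have hpi : (Measure.pi fun _ : Fin D => gaussianReal 0 1).map
      (fun z i => a i + σ * z i) =
      (volume : Measure (Fin D → ℝ)).withDensity
        (fun x => ENNReal.ofReal (gaussDens D σ (WithLp.toLp 2 x - a))) := by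
    have (i : Fin D) : SigmaFinite ((gaussianReal 0 1).map (fun t : ℝ => a i + σ * t)) := by
      rw [hcoord]; infer_instance
    rw [Measure.pi_map_pi (f := fun i t => a i + σ * t) (fun i => by fun_prop)]
    simp_rw [hcoord]
    rw [pi_gaussianReal_eq_withDensity _ hv]
    congr with x
    rw [← prod_gaussianPDFReal_eq_gaussDens hσ]
  have hvol := PiLp.volume_preserving_toLp (Fin D)
  have hmeas : Measurable (WithLp.toLp 2 : (Fin D → ℝ) → EuclideanSpace ℝ (Fin D)) :=
    hvol.measurable
  have hcomm : (fun z : EuclideanSpace ℝ (Fin D) => a + σ • z) ∘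
      (EuclideanSpace.equiv (Fin D) ℝ).symm =
      (WithLp.toLp 2 : (Fin D → ℝ) → EuclideanSpace ℝ (Fin D)) ∘
        fun z i => a i + σ * z i := by
    ext z i
    simp
  have hdens : Measurable fun y : EuclideanSpace ℝ (Fin D) =>
      ENNReal.ofReal (gaussDens D σ (y - a)) := by
    unfold gaussDens; fun_prop
  rw [_root_.stdGaussian, Measure.map_map (by fun_prop) (by fun_prop), hcomm,
    ← Measure.map_map hmeas (by fun_prop), hpi]
  ext s hs
  rw [Measure.map_apply hmeas hs, withDensity_apply _ (hmeas hs), withDensity_apply _ hs,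
    hvol.setLIntegral_comp_preimage hs hdens]

/-- **Bayes' formula** for conditional expectations: if `(X, Y)` has density `ρ` with respect to
`ν ⊗ κ`, then `E[X | Y]` is the `ρ(·, Y)`-weighted average of the identity under `ν`. -/
lemma condExp_ae_eq_of_map_prodMk_eq_withDensity {Ω E F : Type*} [MeasurableSpace Ω]
    [NormedAddCommGroup E] [NormedSpace ℝ E] [CompleteSpace E] [MeasurableSpace E] [BorelSpace E]
    [SecondCountableTopology E] [MeasurableSpace F]
    {μ : Measure Ω} [IsFiniteMeasure μ] {ν : Measure E} [SFinite ν] {κ : Measure F} [SFinite κ]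
    {X : Ω → E} {Y : Ω → F} (hX : Measurable X) (hY : Measurable Y) (hXint : Integrable X μ)
    {ρ : E × F → ℝ} (hρ : Measurable ρ) (hρ0 : ∀ p, 0 ≤ ρ p)
    (hmarg : ∀ y, 0 < ∫ x, ρ (x, y) ∂ν)
    (hlaw : μ.map (fun ω => (X ω, Y ω)) =
      (ν.prod κ).withDensity fun p => ENNReal.ofReal (ρ p)) :
    μ[X | MeasurableSpace.comap Y inferInstance] =ᵐ[μ]
      fun ω => (∫ x, ρ (x, Y ω) ∂ν)⁻¹ • ∫ x, ρ (x, Y ω) • x ∂ν := by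
  have hfst : StronglyMeasurable (Prod.fst : E × F → E) := measurable_fst.stronglyMeasurable
  have hXY : Measurable fun ω => (X ω, Y ω) := hX.prodMk hY
  have hρ' : Measurable fun p => ENNReal.ofReal (ρ p) := hρ.ennreal_ofReal
  have hint (f : E × F → E) (hf : StronglyMeasurable f) :
      Integrable (fun ω => f (X ω, Y ω)) μ ↔ Integrable (fun p => ρ p • f p) (ν.prod κ) := by
    have h := integrable_map_measure (f := fun ω => (X ω, Y ω)) (μ := μ)
      hf.aestronglyMeasurable hXY.aemeasurable
    rw [hlaw, integrable_withDensity_iff_integrable_smul' hρ' (ae_of_all _ fun _ => by simp)] at h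
    simpa only [ENNReal.toReal_ofReal (hρ0 _), Function.comp_def] using h.symm
  have hset (f : E × F → E) (hf : StronglyMeasurable f)
      (hfi : Integrable (fun ω => f (X ω, Y ω)) μ) {t : Set F} (ht : MeasurableSet t) :
      ∫ ω in Y ⁻¹' t, f (X ω, Y ω) ∂μ = ∫ y in t, ∫ x, ρ (x, y) • f (x, y) ∂ν ∂κ := by
    have h := setIntegral_map (g := fun ω => (X ω, Y ω)) (μ := μ)
      (MeasurableSet.univ.prod ht) hf.aestronglyMeasurable hXY.aemeasurable
    have hpre : (fun ω => (X ω, Y ω)) ⁻¹' (Set.univ ×ˢ t) = Y ⁻¹' t := by ext; simp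
    rw [hpre] at h
    rw [← h, hlaw, setIntegral_withDensity_eq_setIntegral_toReal_smul hρ'
      (ae_of_all _ fun _ => by simp) _ (MeasurableSet.univ.prod ht)]
    simp only [ENNReal.toReal_ofReal (hρ0 _)]
    have hfp := ((hint f hf).1 hfi).integrableOn (s := Set.univ ×ˢ t)
    rw [IntegrableOn, ← Measure.prod_restrict, Measure.restrict_univ] at hfp
    rw [← Measure.prod_restrict, Measure.restrict_univ, integral_prod_symm _ hfp]
  set N : F → E := fun y => ∫ x, ρ (x, y) • x ∂ν
  set q : F → ℝ := fun y => ∫ x, ρ (x, y) ∂ν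
  have hNm : StronglyMeasurable N :=
    (hρ.stronglyMeasurable.smul hfst).integral_prod_left'
  have hqm : StronglyMeasurable q := hρ.stronglyMeasurable.integral_prod_left'
  have hhm : StronglyMeasurable fun y => (q y)⁻¹ • N y :=
    hqm.measurable.inv.stronglyMeasurable.smul hNm
  have hhm2 : StronglyMeasurable fun p : E × F => (q p.2)⁻¹ • N p.2 :=
    hhm.comp_measurable measurable_snd
  have hρint (y : F) : Integrable (fun x => ρ (x, y)) ν :=
    Integrable.of_integral_ne_zero (hmarg y).ne'
  have hNint : Integrable N κ :=
    ((hint Prod.fst hfst).1 hXint).integral_prod_right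
  have hhint : Integrable (fun ω => (q (Y ω))⁻¹ • N (Y ω)) μ := by
    refine (hint _ hhm2).2 ((integrable_prod_iff'
      (hρ.stronglyMeasurable.smul hhm2).aestronglyMeasurable).2
      ⟨ae_of_all _ fun y => (hρint y).smul_const ((q y)⁻¹ • N y), ?_⟩)
    refine hNint.norm.congr (ae_of_all _ fun y => ?_)
    simp only [Pi.smul_apply', norm_smul, Real.norm_of_nonneg (hρ0 _), norm_inv]
    rw [integral_mul_const, Real.norm_of_nonneg (hmarg y).le, mul_inv_cancel_left₀ (hmarg y).ne']
  refine (ae_eq_condExp_of_forall_setIntegral_eq hY.comap_le hXint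
    (fun _ _ _ => hhint.integrableOn) ?_ ?_).symm
  · rintro _ ⟨t, ht, rfl⟩ -
    rw [hset _ hhm2 hhint ht, hset Prod.fst hfst hXint ht]
    refine integral_congr_ae (ae_of_all _ fun y => ?_)
    simp only
    rw [integral_smul_const, smul_inv_smul₀ (hmarg y).ne']
  · exact (hhm.comp_measurable (comap_measurable Y)).aestronglyMeasurable

/-- The joint law of `(X, α X + σ Z)` for `Z` standard Gaussian independent of `X`. -/
lemma map_prodMk_add_gaussian_eq_withDensity {D : ℕ} {Ω : Type*} [MeasurableSpace Ω]
    {μ : Measure Ω} [IsProbabilityMeasure μ] (α : ℝ) {σ : ℝ} (hσ : 0 < σ)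
    {X Z : Ω → EuclideanSpace ℝ (Fin D)} (hX : Measurable X) (hZ : Measurable Z)
    (hZlaw : μ.map Z = _root_.stdGaussian D) (hindep : IndepFun X Z μ) :
    μ.map (fun ω => (X ω, α • X ω + σ • Z ω)) =
      ((μ.map X).prod volume).withDensity
        fun p => ENNReal.ofReal (gaussDens D σ (p.2 - α • p.1)) := by
  have : IsProbabilityMeasure (μ.map X) := Measure.isProbabilityMeasure_map hX.aemeasurable
  have : IsProbabilityMeasure (μ.map Z) := Measure.isProbabilityMeasure_map hZ.aemeasurable
  let T : EuclideanSpace ℝ (Fin D) × EuclideanSpace ℝ (Fin D) →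
    EuclideanSpace ℝ (Fin D) × EuclideanSpace ℝ (Fin D) := fun p => (p.1, α • p.1 + σ • p.2)
  have hT : Measurable T := by fun_prop
  have hdens : Measurable fun p : EuclideanSpace ℝ (Fin D) × EuclideanSpace ℝ (Fin D) =>
      ENNReal.ofReal (gaussDens D σ (p.2 - α • p.1)) := by
    unfold gaussDens; fun_prop
  have hcomp : (fun ω => (X ω, α • X ω + σ • Z ω)) = T ∘ fun ω => (X ω, Z ω) := rfl
  rw [hcomp, ← Measure.map_map hT (hX.prodMk hZ),
    hindep.map_prod_eq_prod_map_map hX.aemeasurable hZ.aemeasurable]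
  ext s hs
  rw [Measure.map_apply hT hs, Measure.prod_apply (hT hs), withDensity_apply _ hs,
    ← lintegral_indicator hs, lintegral_prod _ (hdens.indicator hs).aemeasurable]
  refine lintegral_congr fun x => ?_
  have hsx : MeasurableSet (Prod.mk x ⁻¹' s) := measurable_prodMk_left hs
  have hpre : Prod.mk x ⁻¹' (T ⁻¹' s) =
      (fun z => α • x + σ • z) ⁻¹' (Prod.mk x ⁻¹' s) := rfl
  rw [hpre, ← Measure.map_apply (by fun_prop) hsx, hZlaw, map_affine_stdGaussian hσ,
    withDensity_apply _ hsx, ← lintegral_indicator hsx]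
  rfl

lemma gaussDens_norm_le {D : ℕ} (σ : ℝ) (z : EuclideanSpace ℝ (Fin D)) :
    ‖gaussDens D σ z‖ ≤ (2 * π * σ ^ 2) ^ (-(D : ℝ) / 2) := by
  rw [gaussDens, Real.norm_of_nonneg (by positivity)]
  refine mul_le_of_le_one_right (by positivity) (Real.exp_le_one_iff.2 ?_)
  exact div_nonpos_of_nonpos_of_nonneg (by simp) (by positivity)

/-- Tweedie's formula: if `Y_t = α Y₀ + σ Z` with `Z ∼ N(0, I_D)` independent of `Y₀`
and `p_t` is the (smooth, positive) density of `Y_t`, then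
`E[Y₀ | Y_t] = (Y_t + σ² ∇log p_t(Y_t))/α` almost surely. -/
theorem tweedie_formula {D : ℕ} {Ω : Type*} [MeasurableSpace Ω]
    (μ : Measure Ω) [IsProbabilityMeasure μ]
    (α σ : ℝ) (hα : 0 < α) (hσ : 0 < σ)
    (Y0 Z Yt : Ω → EuclideanSpace ℝ (Fin D))
    (hY0 : Measurable Y0) (hZ : Measurable Z)
    (hint : Integrable (fun ω => ‖Y0 ω‖) μ)
    (hZlaw : μ.map Z = stdGaussian D)
    (hindep : IndepFun Y0 Z μ)
    (hYt : ∀ ω, Yt ω = α • Y0 ω + σ • Z ω)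
    (pt : EuclideanSpace ℝ (Fin D) → ℝ)
    (hpt : ∀ y, pt y = ∫ x0, gaussDens D σ (y - α • x0) ∂(μ.map Y0))
    (hpos : ∀ y, 0 < pt y)
    -- differentiation under the integral sign, justified by Gaussian envelopes:
    (hgrad : ∀ y, HasGradientAt pt
      (∫ x0, ((gaussDens D σ (y - α • x0)) / σ ^ 2) • (α • x0 - y) ∂(μ.map Y0)) y) :
    μ[Y0 | MeasurableSpace.comap Yt inferInstance] =ᵐ[μ]
      fun ω => α⁻¹ • (Yt ω + σ ^ 2 • gradient (fun y => Real.log (pt y)) (Yt ω)) := by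
  have hYt' : Yt = fun ω => α • Y0 ω + σ • Z ω := funext hYt
  have hY0int : Integrable Y0 μ := (integrable_norm_iff hY0.aestronglyMeasurable).1 hint
  have hdens : Measurable fun p : EuclideanSpace ℝ (Fin D) × EuclideanSpace ℝ (Fin D) =>
      gaussDens D σ (p.2 - α • p.1) := by
    unfold gaussDens; fun_prop
  have hbayes := condExp_ae_eq_of_map_prodMk_eq_withDensity (ν := μ.map Y0) (κ := volume)
    (Y := Yt) hY0 (by rw [hYt']; fun_prop) hY0int hdens
    (fun p => by unfold gaussDens; positivity) (fun y => hpt y ▸ hpos y)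
    (hYt' ▸ map_prodMk_add_gaussian_eq_withDensity α hσ hY0 hZ hZlaw hindep)
  refine hbayes.trans (ae_of_all _ fun ω => ?_)
  simp only [← hpt]
  generalize Yt ω = y
  have hlog : gradient (fun y => Real.log (pt y)) y =
      (pt y)⁻¹ • ∫ x0, (gaussDens D σ (y - α • x0) / σ ^ 2) • (α • x0 - y) ∂(μ.map Y0) := by
    refine HasGradientAt.gradient ?_
    rw [hasGradientAt_iff_hasFDerivAt, map_smul]
    exact (hgrad y).hasFDerivAt.log (hpos y).ne'
  have hg : Integrable (fun x0 => gaussDens D σ (y - α • x0)) (μ.map Y0) :=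
    Integrable.of_integral_ne_zero (hpt y ▸ (hpos y).ne')
  have hgx : Integrable (fun x0 => gaussDens D σ (y - α • x0) • x0) (μ.map Y0) :=
    ((integrable_map_measure aestronglyMeasurable_id hY0.aemeasurable).2 hY0int).bdd_smul
      ((2 * π * σ ^ 2) ^ (-(D : ℝ) / 2)) hg.aestronglyMeasurable
      (ae_of_all _ fun x0 => gaussDens_norm_le σ _)
  have hsplit : ∫ x0, (gaussDens D σ (y - α • x0) / σ ^ 2) • (α • x0 - y) ∂(μ.map Y0) =
      (σ ^ 2)⁻¹ • (α • ∫ x0, gaussDens D σ (y - α • x0) • x0 ∂(μ.map Y0) - pt y • y) := by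
    rw [hpt, ← integral_smul_const, ← integral_smul, ← integral_sub (hgx.fun_smul α)
      (hg.smul_const y), ← integral_smul]
    congr with x0 : 1
    module
  have hp := (hpos y).ne'
  rw [hlog, hsplit]
  match_scalars <;> field_simp
  ring
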